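/- arXiv:1605.05536 — 2 statements merged into one kernel-verified Lean document; each statement's English description precedes it below -/
import Mathlib

section
/- Let n ≥ 2 be an integer. Then, with the limit taken over real z → 0⁺, ζ(n) = lim_{z→0⁺} ( ∏_{j=0}^{n−1} Γ(1 − z·e(j/n)) − ∏_{j=0}^{n−1} Γ(1 − z·e(j/n))^{−1} ) / (2 z^n). -/
/-- `e(x) := e^{2πix}`. -/
noncomputable def eFn (x : ℂ) : ℂ := Complex.exp (2 * Real.pi * Complex.I * x)

open Finset Filter Topology

lemma one_sub_sum_le_prod_one_sub (a : ℕ → ℝ) (h0 : ∀ k, 0 ≤ a k) (h1 : ∀ k, a k ≤ 1) (m : ℕ) :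
    1 - ∑ k ∈ range m, a k ≤ ∏ k ∈ range m, (1 - a k) := by
  induction m with
  | zero => simp
  | succ m ih =>
    rw [sum_range_succ, prod_range_succ]
    nlinarith [mul_le_mul_of_nonneg_right ih (sub_nonneg.2 (h1 m)),
      mul_nonneg (sum_nonneg fun k (_ : k ∈ range m) => h0 k) (h0 m)]

lemma prod_one_sub_mul_one_add_sum_le_one (a : ℕ → ℝ) (h0 : ∀ k, 0 ≤ a k) (h1 : ∀ k, a k ≤ 1)
    (m : ℕ) : (∏ k ∈ range m, (1 - a k)) * (1 + ∑ k ∈ range m, a k) ≤ 1 := by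
  induction m with
  | zero => simp
  | succ m ih =>
    have hS := sum_nonneg fun k (_ : k ∈ range m) => h0 k
    have hP := prod_nonneg fun k (_ : k ∈ range m) => sub_nonneg.2 (h1 k)
    rw [sum_range_succ, prod_range_succ]
    refine le_trans ?_ ih
    rw [mul_assoc]
    refine mul_le_mul_of_nonneg_left ?_ hP
    nlinarith [mul_nonneg hS (h0 m), h0 m]

lemma eFn_div_eq_pow (n j : ℕ) : eFn ((j : ℂ) / n) = eFn (1 / n) ^ j := by
  rw [eFn, eFn, ← Complex.exp_nat_mul]
  ring_nf

lemma isPrimitiveRoot_eFn (n : ℕ) (hn : n ≠ 0) : IsPrimitiveRoot (eFn (1 / n)) n := by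
  have := Complex.isPrimitiveRoot_exp n hn
  rwa [← mul_one_div] at this

lemma prod_sub_mul_eFn (n : ℕ) (hn : n ≠ 0) (x z : ℂ) :
    ∏ j ∈ range n, (x - z * eFn ((j : ℂ) / n)) = x ^ n - z ^ n := by
  have h := congrArg (Polynomial.eval x)
    (X_pow_sub_C_eq_prod (isPrimitiveRoot_eFn n hn) (Nat.pos_of_ne_zero hn) (rfl : z ^ n = z ^ n))
  simp only [Polynomial.eval_sub, Polynomial.eval_pow, Polynomial.eval_X, Polynomial.eval_C,
    Polynomial.eval_prod] at h
  rw [h]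
  exact prod_congr rfl fun j _ => by rw [eFn_div_eq_pow, mul_comm]

lemma sum_eFn (n : ℕ) (hn : 1 < n) : ∑ j ∈ range n, eFn ((j : ℂ) / n) = 0 := by
  simp_rw [eFn_div_eq_pow]
  exact (isPrimitiveRoot_eFn n (by lia)).geom_sum_eq_zero hn

lemma prod_GammaSeq_one_sub_mul_eFn (n : ℕ) (hn : 1 < n) (z : ℂ) (m : ℕ) (hm : m ≠ 0) :
    (∏ j ∈ range n, Complex.GammaSeq (1 - z * eFn ((j : ℂ) / n)) m)⁻¹ * ((m : ℂ) / (m + 1)) ^ n =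
      ∏ k ∈ range (m + 1), (1 - z ^ n / ((k : ℂ) + 1) ^ n) := by
  have hm' : (m : ℂ) ≠ 0 := by exact_mod_cast hm
  have hpow : ∏ j ∈ range n, (m : ℂ) ^ (1 - z * eFn ((j : ℂ) / n)) = (m : ℂ) ^ n := by
    simp_rw [Complex.cpow_def_of_ne_zero hm']
    rw [← Complex.exp_sum, ← mul_sum, sum_sub_distrib, ← mul_sum, sum_eFn n hn, mul_zero,
      sub_zero, sum_const, card_range, nsmul_one, mul_comm, Complex.exp_nat_mul,
      Complex.exp_log hm']
  have hfac : ∏ k ∈ range (m + 1), ((k : ℂ) + 1) ^ n = ((m + 1) * m.factorial : ℂ) ^ n := by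
    rw [prod_pow]
    congr 1
    have := Finset.prod_range_add_one_eq_factorial (m + 1)
    rw [Nat.factorial_succ] at this
    exact_mod_cast this
  have hnum : ∏ j ∈ range n, ∏ k ∈ range (m + 1), (1 - z * eFn ((j : ℂ) / n) + k) =
      (∏ k ∈ range (m + 1), (1 - z ^ n / ((k : ℂ) + 1) ^ n)) *
        ((m + 1) * m.factorial : ℂ) ^ n := by
    rw [Finset.prod_comm, ← hfac, ← prod_mul_distrib]
    refine prod_congr rfl fun k _ => ?_
    have hk : ((k : ℂ) + 1) ^ n ≠ 0 := pow_ne_zero _ (Nat.cast_add_one_ne_zero k)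
    rw [sub_mul, one_mul, div_mul_cancel₀ _ hk, ← prod_sub_mul_eFn n (by lia)]
    exact prod_congr rfl fun j _ => by ring
  simp only [Complex.GammaSeq]
  rw [prod_div_distrib, prod_mul_distrib, hpow, hnum, prod_const, card_range, inv_div]
  have h1 : (m : ℂ) + 1 ≠ 0 := Nat.cast_add_one_ne_zero m
  have h2 : (m.factorial : ℂ) ≠ 0 := by exact_mod_cast m.factorial_ne_zero
  generalize ∏ k ∈ range (m + 1), (1 - z ^ n / ((k : ℂ) + 1) ^ n) = R
  rw [mul_pow, div_pow]
  field_simp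

lemma prod_Gamma_one_sub_mul_eFn_ne_zero (n : ℕ) (z : ℝ) (h0 : 0 < z) (h1 : z < 1) :
    ∏ j ∈ range n, Complex.Gamma (1 - z * eFn ((j : ℂ) / n)) ≠ 0 := by
  refine prod_ne_zero_iff.2 fun j _ => Complex.Gamma_ne_zero_of_re_pos ?_
  have hnorm : ‖eFn ((j : ℂ) / n)‖ = 1 := by
    have : eFn ((j : ℂ) / n) = Complex.exp ((2 * Real.pi * (j / n) : ℝ) * Complex.I) := by
      rw [eFn]; push_cast; ring_nf
    rw [this, Complex.norm_exp_ofReal_mul_I]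
  have := Complex.re_le_norm (z * eFn ((j : ℂ) / n))
  rw [norm_mul, hnorm, Complex.norm_real, Real.norm_of_nonneg h0.le] at this
  rw [Complex.sub_re, Complex.one_re]
  linarith

lemma tendsto_prod_inv_prod_Gamma (n : ℕ) (hn : 1 < n) (z : ℝ) (h0 : 0 < z) (h1 : z < 1) :
    Tendsto (fun m : ℕ => ((∏ k ∈ range m, (1 - z ^ n / ((k : ℝ) + 1) ^ n) : ℝ) : ℂ)) atTop
      (𝓝 (∏ j ∈ range n, Complex.Gamma (1 - z * eFn ((j : ℂ) / n)))⁻¹) := by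
  rw [← tendsto_add_atTop_iff_nat 1]
  have hG := (tendsto_finsetProd (range n) fun j _ =>
    Complex.GammaSeq_tendsto_Gamma (1 - z * eFn ((j : ℂ) / n))).inv₀
      (prod_Gamma_one_sub_mul_eFn_ne_zero n z h0 h1)
  have hr := (tendsto_natCast_div_add_atTop (𝕜 := ℂ) 1).pow n
  have h := hG.mul hr
  rw [one_pow, mul_one] at h
  refine h.congr' ?_
  filter_upwards [eventually_ne_atTop 0] with m hm
  rw [prod_GammaSeq_one_sub_mul_eFn n hn z m hm]
  push_cast
  rfl

lemma exists_prod_Gamma_eq_inv (n : ℕ) (hn : 1 < n) (S : ℝ)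
    (hS : HasSum (fun k : ℕ => 1 / ((k : ℝ) + 1) ^ n) S) (z : ℝ) (h0 : 0 < z) (h1 : z < 1) :
    ∃ Q : ℝ, ∏ j ∈ range n, Complex.Gamma (1 - z * eFn ((j : ℂ) / n)) = ((Q⁻¹ : ℝ) : ℂ) ∧
      1 - z ^ n * S ≤ Q ∧ Q * (1 + z ^ n * S) ≤ 1 := by
  have hlim := tendsto_prod_inv_prod_Gamma n hn z h0 h1
  set P := ∏ j ∈ range n, Complex.Gamma (1 - z * eFn ((j : ℂ) / n))
  have hre : Tendsto (fun m : ℕ => ∏ k ∈ range m, (1 - z ^ n / ((k : ℝ) + 1) ^ n)) atTop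
      (𝓝 (P⁻¹).re) := by
    simpa only [Function.comp_def, Complex.ofReal_re] using
      (Complex.continuous_re.tendsto _).comp hlim
  have hPQ : P⁻¹ = ((P⁻¹).re : ℂ) :=
    tendsto_nhds_unique hlim ((Complex.continuous_ofReal.tendsto _).comp hre)
  have hs : Tendsto (fun m : ℕ => ∑ k ∈ range m, z ^ n / ((k : ℝ) + 1) ^ n) atTop
      (𝓝 (z ^ n * S)) := by
    simpa only [mul_one_div] using (hS.mul_left (z ^ n)).tendsto_sum_nat
  have ha0 : ∀ k : ℕ, 0 ≤ z ^ n / ((k : ℝ) + 1) ^ n := fun k => by positivity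
  have ha1 : ∀ k : ℕ, z ^ n / ((k : ℝ) + 1) ^ n ≤ 1 := fun k => by
    rw [← div_pow]
    refine pow_le_one₀ (by positivity) ((div_le_one (by positivity)).2 ?_)
    linarith [(Nat.cast_nonneg k : (0 : ℝ) ≤ k)]
  refine ⟨(P⁻¹).re, ?_, ?_, ?_⟩
  · rw [Complex.ofReal_inv, ← hPQ, inv_inv]
  · exact le_of_tendsto_of_tendsto' (hs.const_sub 1) hre (one_sub_sum_le_prod_one_sub _ ha0 ha1)
  · exact le_of_tendsto' (hre.mul (hs.const_add 1))
      (prod_one_sub_mul_one_add_sum_le_one _ ha0 ha1)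

lemma inv_sub_self_div_mem_Icc {w S Q : ℝ} (hw : 0 < w) (hS : 0 ≤ S) (hwS : w * S < 1)
    (hQ : 1 - w * S ≤ Q) (hQ' : Q * (1 + w * S) ≤ 1) :
    (Q⁻¹ - Q) / (2 * w) ∈
      Set.Icc (S * (2 + w * S) / (2 * (1 + w * S))) (S * (2 + -w * S) / (2 * (1 + -w * S))) := by
  have hQ0 : 0 < Q := by linarith
  have hp : 0 < 1 + w * S := by positivity
  have hm : 0 < 1 - w * S := by linarith
  have hm' : 0 < 1 + -w * S := by linarith
  have hlo : S * (2 + w * S) / (2 * (1 + w * S)) = ((1 + w * S) - (1 + w * S)⁻¹) / (2 * w) := by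
    field_simp
    ring
  have hhi : S * (2 + -w * S) / (2 * (1 + -w * S)) =
      ((1 - w * S)⁻¹ - (1 - w * S)) / (2 * w) := by
    rw [show 1 + -w * S = 1 - w * S by ring]
    field_simp
    ring
  have hQp : Q ≤ (1 + w * S)⁻¹ := by rwa [← one_div, le_div_iff₀ hp]
  have hpQ : 1 + w * S ≤ Q⁻¹ := (le_inv_comm₀ hQ0 hp).1 hQp
  have hQm : Q⁻¹ ≤ (1 - w * S)⁻¹ := inv_anti₀ hm hQ
  rw [hlo, hhi]
  constructor <;> gcongr

lemma exists_hasSum_riemannZeta_eq (n : ℕ) (hn : 1 < n) :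
    ∃ S : ℝ, HasSum (fun k : ℕ => 1 / ((k : ℝ) + 1) ^ n) S ∧ riemannZeta n = S := by
  have hs : Summable (fun k : ℕ => 1 / ((k : ℝ) + 1) ^ n) := by
    exact_mod_cast (summable_nat_add_iff 1).2 (Real.summable_one_div_nat_pow.2 hn)
  refine ⟨_, hs.hasSum, ?_⟩
  rw [zeta_eq_tsum_one_div_nat_add_one_cpow (by simpa using hn), Complex.ofReal_tsum]
  simp

lemma tendsto_ofReal_of_eventually_mem_Icc {α : Type*} {l : Filter α} {F : α → ℂ} {lo hi : α → ℝ}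
    {S : ℝ} (hlo : Tendsto lo l (𝓝 S)) (hhi : Tendsto hi l (𝓝 S))
    (h : ∀ᶠ z in l, ∃ r ∈ Set.Icc (lo z) (hi z), F z = (r : ℂ)) : Tendsto F l (𝓝 (S : ℂ)) := by
  have hre : Tendsto (fun z => (F z).re) l (𝓝 S) :=
    tendsto_of_tendsto_of_tendsto_of_le_of_le' hlo hhi
      (h.mono fun z ⟨r, hr, hF⟩ => by simpa only [hF, Complex.ofReal_re] using hr.1)
      (h.mono fun z ⟨r, hr, hF⟩ => by simpa only [hF, Complex.ofReal_re] using hr.2)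
  refine ((Complex.continuous_ofReal.tendsto S).comp hre).congr' (h.mono fun z ⟨r, _, hF⟩ => ?_)
  simp only [Function.comp_apply, hF, Complex.ofReal_re]

/-- for an integer `n ≥ 2`, with the limit over real `z → 0⁺`,
`ζ(n) = lim_{z→0⁺} (∏_{j<n} Γ(1 - z e(j/n)) - ∏_{j<n} Γ(1 - z e(j/n))⁻¹) / (2 z^n)`. -/
theorem riemannZeta_eq_limit_gammaProd_sub_inv (n : ℕ) (hn : 2 ≤ n) :
    Filter.Tendsto
      (fun z : ℝ =>
        ((∏ j ∈ Finset.range n, Complex.Gamma (1 - (z : ℂ) * eFn ((j : ℂ) / (n : ℂ)))) -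
            ∏ j ∈ Finset.range n, (Complex.Gamma (1 - (z : ℂ) * eFn ((j : ℂ) / (n : ℂ))))⁻¹) /
          (2 * (z : ℂ) ^ n))
      (nhdsWithin 0 (Set.Ioi 0))
      (nhds (riemannZeta (n : ℂ))) := by
  obtain ⟨S, hS, hζ⟩ := exists_hasSum_riemannZeta_eq n hn
  have hS0 : 0 ≤ S := hS.nonneg fun k => by positivity
  have hz : Tendsto (fun z : ℝ => z ^ n) (𝓝[>] 0) (𝓝 0) := by
    have h : Tendsto (fun z : ℝ => z ^ n) (𝓝 0) (𝓝 (0 ^ n)) := (continuous_pow n).tendsto 0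
    rw [zero_pow (by lia)] at h
    exact h.mono_left nhdsWithin_le_nhds
  have hbound : Tendsto (fun t : ℝ => S * (2 + t * S) / (2 * (1 + t * S))) (𝓝 0) (𝓝 S) := by
    have h : ContinuousAt (fun t : ℝ => S * (2 + t * S) / (2 * (1 + t * S))) 0 :=
      ContinuousAt.div (by fun_prop) (by fun_prop) (by norm_num)
    simpa [ContinuousAt] using h
  have hzneg : Tendsto (fun z : ℝ => -z ^ n) (𝓝[>] 0) (𝓝 0) := by simpa using hz.neg
  have hsmall : ∀ᶠ z : ℝ in 𝓝[>] 0, z ^ n * S < 1 := by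
    have h := hz.mul_const S
    rw [zero_mul] at h
    exact h.eventually_lt_const one_pos
  have hpos : ∀ᶠ z : ℝ in 𝓝[>] 0, z ∈ Set.Ioo 0 1 := Ioo_mem_nhdsGT one_pos
  rw [hζ]
  refine tendsto_ofReal_of_eventually_mem_Icc (hbound.comp hz) (hbound.comp hzneg) ?_
  filter_upwards [hsmall, hpos] with z hzS hz01
  obtain ⟨Q, hPQ, hQ, hQ'⟩ := exists_prod_Gamma_eq_inv n hn S hS z hz01.1 hz01.2
  refine ⟨_, inv_sub_self_div_mem_Icc (pow_pos hz01.1 n) hS0 hzS hQ hQ', ?_⟩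
  rw [prod_inv_distrib, hPQ]
  push_cast
  rw [inv_inv]
end

section
/- For every integer m ≥ 2, the partition zeta function over partitions into multiples of m satisfies ζ_{𝒫_{mℕ}}(2) = π/(m·sin(π/m)); that is, the sum of n_λ^{−2} over all partitions λ all of whose parts are divisible by m converges to π/(m·sin(π/m)), and equivalently ∏_{j=1}^{∞} (1 − (mj)^{−2})^{−1} = π/(m·sin(π/m)). -/
open Filter

/-- The multisets over `insert a S` are obtained from those over `S` by adding copies of `a`. -/
def Multiset.natProdEquivInsert {ι : Type*} [DecidableEq ι] {a : ι} {S : Finset ι} (ha : a ∉ S) :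
    ℕ × {s : Multiset ι | ∀ x ∈ s, x ∈ S} ≃ {s : Multiset ι | ∀ x ∈ s, x ∈ insert a S} where
  toFun p := ⟨replicate p.1 a + p.2.1, fun x hx => by
    rcases mem_add.1 hx with h | h
    · exact eq_of_mem_replicate h ▸ Finset.mem_insert_self a S
    · exact Finset.mem_insert_of_mem (p.2.2 x h)⟩
  invFun s := (s.1.count a, ⟨s.1.filter (· ≠ a), fun x hx => by
    rw [mem_filter] at hx
    exact Finset.mem_of_mem_insert_of_ne (s.2 x hx.1) hx.2⟩)
  left_inv := by
    rintro ⟨n, s, hs⟩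
    have has : a ∉ s := fun h => ha (hs a h)
    refine Prod.ext ?_ (Subtype.ext ?_)
    · simp [count_eq_zero_of_notMem has]
    · have h : ∀ x ∈ s, x ≠ a := fun x hx e => has (e ▸ hx)
      simp only [filter_add, filter_eq_self.2 h, add_eq_right]
      exact filter_eq_nil.2 fun x hx => not_not.2 (eq_of_mem_replicate hx)
  right_inv s := Subtype.ext <| by
    simp only [← filter_eq']
    exact filter_add_not _ _

/-- Euler product over finitely many generators. -/
theorem hasSum_multiset_prod_of_finset {ι : Type*} [DecidableEq ι] {f : ι → ℝ}
    (h0 : ∀ i, 0 ≤ f i) (h1 : ∀ i, f i < 1) (S : Finset ι) :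
    HasSum (fun s : {s : Multiset ι | ∀ x ∈ s, x ∈ S} => (s.1.map f).prod)
      (∏ i ∈ S, (1 - f i)⁻¹) := by
  induction S using Finset.induction_on with
  | empty =>
    convert! hasSum_single (⟨0, by simp⟩ : {s : Multiset ι | ∀ x ∈ s, x ∈ (∅ : Finset ι)})
      fun s hs => absurd (Subtype.ext (Multiset.eq_zero_of_forall_notMem
        fun x hx => Finset.notMem_empty x (s.2 x hx))) hs
  | insert a S ha ih =>
    rw [Finset.prod_insert ha, ← (Multiset.natProdEquivInsert ha).hasSum_iff]
    have hg := hasSum_geometric_of_lt_one (h0 a) (h1 a)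
    convert! hg.mul ih (hg.summable.mul_of_nonneg ih.summable (fun n => pow_nonneg (h0 a) n)
      fun s => Multiset.prod_map_nonneg fun x _ => h0 x) using 1
    ext p
    simp [Multiset.natProdEquivInsert]

/-- Euler product for sums of a nonnegative multiplicative weight over all multisets. -/
theorem hasSum_multiset_prod_of_hasProd {ι : Type*} {f : ι → ℝ} {P : ℝ}
    (h0 : ∀ i, 0 ≤ f i) (h1 : ∀ i, f i < 1) (hP : HasProd (fun i => (1 - f i)⁻¹) P) :
    HasSum (fun s : Multiset ι => (s.map f).prod) P := by
  classical
  have hnn (s : Multiset ι) : 0 ≤ (s.map f).prod :=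
    Multiset.prod_map_nonneg fun x _ => h0 x
  have hone (i : ι) : 1 ≤ (1 - f i)⁻¹ :=
    (one_le_inv₀ (sub_pos.2 (h1 i))).2 (sub_le_self _ (h0 i))
  have hle (S : Finset ι) : ∏ i ∈ S, (1 - f i)⁻¹ ≤ P :=
    ge_of_tendsto hP <| (eventually_ge_atTop S).mono fun T hT =>
      Finset.prod_le_prod_of_subset_of_one_le hT
        (fun i _ => zero_le_one.trans (hone i)) fun i _ _ => hone i
  have hbound (F : Finset (Multiset ι)) : ∑ s ∈ F, (s.map f).prod ≤ P := by
    refine le_trans ?_ (hle (F.sup Multiset.toFinset))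
    let A := {s : Multiset ι | ∀ x ∈ s, x ∈ F.sup Multiset.toFinset}
    have h : HasSum (A.indicator fun s => (s.map f).prod)
        (∏ i ∈ F.sup Multiset.toFinset, (1 - f i)⁻¹) :=
      hasSum_subtype_iff_indicator.1 (hasSum_multiset_prod_of_finset h0 h1 _)
    have hF : ∀ s ∈ F, A.indicator (fun s => (s.map f).prod) s = (s.map f).prod := fun s hs =>
      have hsA : s ∈ A := fun x hx => Finset.mem_sup.2 ⟨s, hs, Multiset.mem_toFinset.2 hx⟩
      Set.indicator_of_mem hsA _
    rw [← Finset.sum_congr rfl hF]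
    exact sum_le_hasSum F (fun s _ => Set.indicator_nonneg (fun s _ => hnn s) s) h
  have hs : Summable fun s : Multiset ι => (s.map f).prod := summable_of_sum_le hnn hbound
  refine hs.hasSum_iff.2 (le_antisymm (hs.tsum_le_of_sum_le hbound) (le_of_tendsto' hP fun S => ?_))
  rw [← (hasSum_multiset_prod_of_finset h0 h1 S).tsum_eq]
  exact hs.tsum_subtype_le _ _ hnn

/-- The multisets of positive multiples of `m` correspond to the multisets of naturals. -/
def Multiset.equivPosMultiples {m : ℕ} (hm : 0 < m) :
    Multiset ℕ ≃ {μ : Multiset ℕ // ∀ x ∈ μ, 0 < x ∧ m ∣ x} where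
  toFun s := ⟨s.map fun j => m * (j + 1), by
    simp only [mem_map]
    rintro _ ⟨j, -, rfl⟩
    exact ⟨by positivity, dvd_mul_right _ _⟩⟩
  invFun μ := μ.1.map fun x => x / m - 1
  left_inv s := by simp [Nat.mul_div_cancel_left _ hm]
  right_inv μ := Subtype.ext <| by
    dsimp only
    rw [map_map]
    refine (map_congr rfl fun x hx => ?_).trans (map_id _)
    obtain ⟨hx0, k, rfl⟩ := μ.2 x hx
    have hk : 0 < k := Nat.pos_of_mul_pos_left hx0
    simp [Nat.mul_div_cancel_left _ hm, Nat.sub_add_cancel hk]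

/-- Euler's sine product at `π / m`, inverted. -/
theorem hasProd_inv_one_sub_multiples_sq {m : ℕ} (hm : 2 ≤ m) :
    HasProd (fun j : ℕ => (1 - (((m * (j + 1) : ℕ) : ℝ) ^ 2)⁻¹)⁻¹)
      (Real.pi / (m * Real.sin (Real.pi / m))) := by
  have hm0 : (0 : ℝ) < m := by positivity
  have hsin : 0 < Real.sin (Real.pi / m) := by
    refine Real.sin_pos_of_pos_of_lt_pi (by positivity) (div_lt_self Real.pi_pos ?_)
    exact_mod_cast hm
  have hsum : Summable fun j : ℕ => -(((m * (j + 1) : ℕ) : ℝ) ^ 2)⁻¹ := by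
    refine Summable.neg ?_
    have h := ((summable_nat_add_iff 1).2
      (Real.summable_nat_pow_inv.2 one_lt_two)).mul_left (((m : ℝ) ^ 2)⁻¹)
    refine h.congr fun j => ?_
    push_cast
    rw [mul_pow, mul_inv]
  have hmul := (Real.multipliable_one_add_of_summable hsum).hasProd
  have hlim := (Real.tendsto_euler_sin_prod (m : ℝ)⁻¹).const_mul (Real.pi * (m : ℝ)⁻¹)⁻¹
  have heq := tendsto_nhds_unique hmul.tendsto_prod_nat <| hlim.congr fun n => by
    rw [inv_mul_cancel_left₀ (by positivity)]
    refine Finset.prod_congr rfl fun j _ => ?_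
    push_cast
    rw [mul_pow, mul_inv, inv_pow, sub_eq_add_neg, div_eq_mul_inv]
  rw [heq, ← div_eq_mul_inv Real.pi] at hmul
  convert! hmul.inv₀ (by positivity) using 1
  rw [mul_inv, inv_inv]
  field_simp


/-- for every integer `m ≥ 2`, the sum of `n_λ^{-2}` over all partitions `λ`
whose parts are all positive multiples of `m` (encoded as multisets) converges to
`π/(m·sin(π/m))`, and equivalently `∏_{j≥1} (1 − (mj)^{-2})⁻¹ = π/(m·sin(π/m))`. -/
theorem partitionZeta_multiples_two (m : ℕ) (hm : 2 ≤ m) :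
    Summable (fun μ : {μ : Multiset ℕ // ∀ x ∈ μ, 0 < x ∧ m ∣ x} =>
        ((μ.1.prod : ℝ) ^ 2)⁻¹) ∧
    (∑' μ : {μ : Multiset ℕ // ∀ x ∈ μ, 0 < x ∧ m ∣ x}, ((μ.1.prod : ℝ) ^ 2)⁻¹ =
      Real.pi / (m * Real.sin (Real.pi / m))) ∧
    Multipliable (fun j : ℕ => (1 - (((m * (j + 1) : ℕ) : ℝ) ^ 2)⁻¹)⁻¹) ∧
    (∏' j : ℕ, (1 - (((m * (j + 1) : ℕ) : ℝ) ^ 2)⁻¹)⁻¹ =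
      Real.pi / (m * Real.sin (Real.pi / m))) := by
  have hP := hasProd_inv_one_sub_multiples_sq hm
  have hm0 : 0 < m := by lia
  have h1 (j : ℕ) : (((m * (j + 1) : ℕ) : ℝ) ^ 2)⁻¹ < 1 := by
    have h : 1 < m * (j + 1) := by nlinarith
    exact inv_lt_one_of_one_lt₀ (one_lt_pow₀ (by exact_mod_cast h) two_ne_zero)
  have hS : HasSum (fun μ : {μ : Multiset ℕ // ∀ x ∈ μ, 0 < x ∧ m ∣ x} =>
      ((μ.1.prod : ℝ) ^ 2)⁻¹) (Real.pi / (m * Real.sin (Real.pi / m))) := by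
    rw [← (Multiset.equivPosMultiples hm0).hasSum_iff]
    convert! hasSum_multiset_prod_of_hasProd (fun j => by positivity) h1 hP using 1
    ext s
    simp only [Function.comp_apply, Multiset.equivPosMultiples, Equiv.coe_fn_mk,
      Nat.cast_multiset_prod, Multiset.map_map, Multiset.prod_map_inv, Multiset.prod_map_pow]
  exact ⟨hS.summable, hS.tsum_eq, hP.multipliable, hP.tprod_eq⟩
end
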